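/- Let ρ>1 and α≥1. Let V:ℝ→ℝ be bounded and locally Lipschitz with flow Φ (i.e. ∂_tΦ(x,t)=V(Φ(x,t)), Φ(x,0)=x), let λ:ℝ→ℝ₊ be continuous with λ̄=sup_x λ(x)<∞, and let k(x,dy) be a Markov kernel with jumps bounded by M>0 (∫1_{{|x−y|>M}}k(x,dy)=0 for all x). Let P,P̃ ∈ 𝒫̂_{ρα} with cumulative distribution functions F, F̃, let c,C>0 be constants such that for all y>0, sup_x F(x+y)/F(x) ≤ ce^{Cy} and sup_x (1−F)(x−y)/(1−F)(x) ≤ ce^{Cy}. Let T(x)=F̃^{-1}(F(x)) and let ψ be a C¹ function with ψ'(x)=ρ|x−T(x)|^{ρ−2}(T(x)−x). For μ∈[1,∞) define L^μψ(x)=μ(ψ(Φ(x,1/μ))−ψ(x))+λ(x)∫(ψ(y)−ψ(x))k(x,dy), and L^∞ψ(x)=V(x)ψ'(x)+λ(x)∫(ψ(y)−ψ(x))k(x,dy). Then for every μ∈[1,∞], ∫ |L^μψ(x)|^α P(dx) ≤ 2^{α−1}‖V‖_∞^α ρ^α 2^{(α(ρ−1)−1)⁺} ( 2ce^{C‖V‖_∞}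 ∫|x|^{α(ρ−1)} P̃(dx) + 2^{(α(ρ−1)−1)⁺}( ∫|x|^{α(ρ−1)} P(dx) + ‖V‖_∞^{α(ρ−1)} ) ) + 2^{α−1} λ̄^α 2^{αρ−1} ( (1+2^{αρ−1}) ∫|x|^{αρ} P(dx) + 2^{αρ−1} M^{αρ} + (1+2ce^{CM}) ∫|x|^{αρ} P̃(dx) ). -/

import Mathlib

open MeasureTheory ProbabilityTheory Set
open scoped ENNReal

/-- The right-hand side of the bound of STATEMENT 18. -/
noncomputable def stmt18RHS (ρ α Vn lbar c C M : ℝ) (P Pt : Measure ℝ) : ℝ :=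
  2 ^ (α - 1) * Vn ^ α * ρ ^ α * 2 ^ max (α * (ρ - 1) - 1) 0 *
      (2 * c * Real.exp (C * Vn) * (∫ x, |x| ^ (α * (ρ - 1)) ∂Pt)
        + 2 ^ max (α * (ρ - 1) - 1) 0 *
            ((∫ x, |x| ^ (α * (ρ - 1)) ∂P) + Vn ^ (α * (ρ - 1))))
    + 2 ^ (α - 1) * lbar ^ α * 2 ^ (α * ρ - 1) *
        ((1 + 2 ^ (α * ρ - 1)) * (∫ x, |x| ^ (α * ρ) ∂P) + 2 ^ (α * ρ - 1) * M ^ (α * ρ)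
          + (1 + 2 * c * Real.exp (C * M)) * (∫ x, |x| ^ (α * ρ) ∂Pt))

/-- The two-term power inequality with a constant valid for all nonnegative exponents. -/
theorem rpow_add_le_two_rpow_mul {a b p : ℝ} (ha : 0 ≤ a) (hb : 0 ≤ b) (hp : 0 ≤ p) :
    (a + b) ^ p ≤ 2 ^ max (p - 1) 0 * (a ^ p + b ^ p) := by
  rcases le_total p 1 with h | h
  · rw [max_eq_right (by linarith), Real.rpow_zero, one_mul]
    exact Real.rpow_add_le_add_rpow ha hb hp h
  · rw [max_eq_left (by linarith)]
    lift a to NNReal using ha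
    lift b to NNReal using hb
    exact_mod_cast NNReal.rpow_add_le_mul_rpow_add_rpow a b h

/-- Domination of measures on closed left half-lines extends to all lower sets. -/
theorem IsLowerSet.measure_le_mul_of_Iic {μ ν : Measure ℝ} {K : ℝ≥0∞}
    (h : ∀ x, μ (Iic x) ≤ K * ν (Iic x)) {S : Set ℝ} (hS : IsLowerSet S) :
    μ S ≤ K * ν S := by
  by_cases hmax : ∃ m ∈ S, ∀ x ∈ S, x ≤ m
  · obtain ⟨m, hm, hle⟩ := hmax
    have : S = Iic m := Subset.antisymm hle fun x hx => hS hx hm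
    rw [this]
    exact h m
  push Not at hmax
  have hSU : S = ⋃ q ∈ {q : ℚ | (q : ℝ) ∈ S}, Iic (q : ℝ) := by
    ext x
    simp only [mem_ofPred_eq, mem_iUnion, mem_Iic, exists_prop]
    constructor
    · intro hx
      obtain ⟨y, hy, hxy⟩ := hmax x hx
      obtain ⟨q, hq1, hq2⟩ := exists_rat_btwn hxy
      exact ⟨q, hS hq2.le hy, hq1.le⟩
    · rintro ⟨q, hq, hx⟩
      exact hS hx hq
  have hdir : DirectedOn (Function.onFun (· ⊆ ·) fun q : ℚ => Iic (q : ℝ))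
      {q : ℚ | (q : ℝ) ∈ S} := by
    intro p hp q hq
    rcases le_total p q with hpq | hpq
    · exact ⟨q, hq, Iic_subset_Iic.2 (by exact_mod_cast hpq), Subset.rfl⟩
    · exact ⟨p, hp, Subset.rfl, Iic_subset_Iic.2 (by exact_mod_cast hpq)⟩
  conv_lhs => rw [hSU]
  rw [measure_biUnion_eq_iSup (to_countable _) hdir]
  refine iSup₂_le fun q hq => (h q).trans ?_
  gcongr
  exact fun x hx => hS hx hq

/-- Stochastic domination up to a constant, tested on nonnegative antitone functions. -/
theorem Antitone.lintegral_ofReal_le_mul {μ ν : Measure ℝ} {K : ℝ≥0∞} (hK : K ≠ ∞)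
    (h : ∀ x, μ (Iic x) ≤ K * ν (Iic x)) {f : ℝ → ℝ} (hf : Antitone f) (hf0 : ∀ x, 0 ≤ f x) :
    ∫⁻ x, ENNReal.ofReal (f x) ∂μ ≤ K * ∫⁻ x, ENNReal.ofReal (f x) ∂ν := by
  rw [lintegral_eq_lintegral_meas_lt μ (.of_forall hf0) hf.measurable.aemeasurable,
    lintegral_eq_lintegral_meas_lt ν (.of_forall hf0) hf.measurable.aemeasurable,
    ← lintegral_const_mul' _ _ hK]
  exact lintegral_mono fun t =>
    IsLowerSet.measure_le_mul_of_Iic h fun x y hxy hx => hx.trans_le (hf hxy)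

/-- Left shifts enlarge integrals of antitone functions by at most the left-tail constant. -/
theorem Antitone.lintegral_ofReal_shift_le {P : Measure ℝ} {K : ℝ≥0∞} (hK : K ≠ ∞) {h : ℝ}
    (hP : ∀ x, P (Iic (x + h)) ≤ K * P (Iic x)) {f : ℝ → ℝ} (hf : Antitone f)
    (hf0 : ∀ x, 0 ≤ f x) :
    ∫⁻ x, ENNReal.ofReal (f (x - h)) ∂P ≤ K * ∫⁻ x, ENNReal.ofReal (f x) ∂P := by
  have hm : Measurable fun x : ℝ => x - h := by fun_prop
  rw [← lintegral_map (f := fun x => ENNReal.ofReal (f x)) hf.measurable.ennreal_ofReal hm]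
  refine hf.lintegral_ofReal_le_mul hK (fun x => ?_) hf0
  rw [Measure.map_apply hm measurableSet_Iic]
  convert hP x using 2
  ext y
  simp

/-- Right shifts enlarge integrals of monotone functions by at most the right-tail constant. -/
theorem Monotone.lintegral_ofReal_shift_le {P : Measure ℝ} {K : ℝ≥0∞} (hK : K ≠ ∞) {h : ℝ}
    (hP : ∀ x, P (Ici (x - h)) ≤ K * P (Ici x)) {f : ℝ → ℝ} (hf : Monotone f)
    (hf0 : ∀ x, 0 ≤ f x) :
    ∫⁻ x, ENNReal.ofReal (f (x + h)) ∂P ≤ K * ∫⁻ x, ENNReal.ofReal (f x) ∂P := by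
  have hg : Antitone fun x => f (-x) := fun x y hxy => hf (neg_le_neg hxy)
  have hm : Measurable fun x : ℝ => -x := by fun_prop
  have key := hg.lintegral_ofReal_shift_le (P := P.map fun x => -x) (h := h) hK (fun x => ?_)
    fun x => hf0 _
  · have hgm : Measurable fun x => f (-(x - h)) := hg.measurable.comp (measurable_id.sub_const h)
    rw [lintegral_map hgm.ennreal_ofReal hm,
      lintegral_map hg.measurable.ennreal_ofReal hm] at key
    refine le_of_eq_of_le ?_ (key.trans_eq ?_)
    · congr! 4
      ring
    · simp
  · rw [Measure.map_apply hm measurableSet_Iic, Measure.map_apply hm measurableSet_Iic]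
    convert hP (-x) using 2
    · ext y
      simp only [mem_preimage, mem_Iic, mem_Ici]
      constructor <;> intro <;> linarith
    · congr 1
      ext y
      simp only [mem_preimage, mem_Iic, mem_Ici]
      constructor <;> intro <;> linarith

/-- A measure with continuous distribution function has no atoms. -/
theorem nullSingletonClass_of_continuous_cdf {P : Measure ℝ} [IsProbabilityMeasure P] {F : ℝ → ℝ}
    (hF : ∀ x, F x = (P (Iic x)).toReal) (hFc : Continuous F) : NullSingletonClass P := by
  have hcdf : ⇑(cdf P) = F := by
    ext x
    rw [cdf_eq_real, hF, measureReal_def]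
  refine ⟨fun x => ?_⟩
  rw [← measure_cdf P, StieltjesFunction.measure_singleton, hcdf,
    hFc.continuousWithinAt.leftLim_eq, sub_self, ENNReal.ofReal_zero]

/-- A continuous, strictly increasing distribution function is onto `(0, 1)`. -/
theorem range_eq_Ioo_of_cdf {P : Measure ℝ} [IsProbabilityMeasure P] {F : ℝ → ℝ}
    (hF : ∀ x, F x = (P (Iic x)).toReal) (hFc : Continuous F) (hFm : StrictMono F) :
    range F = Ioo 0 1 := by
  have hcdf : ⇑(cdf P) = F := by
    ext x
    rw [cdf_eq_real, hF, measureReal_def]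
  have h0 := hcdf ▸ tendsto_cdf_atBot P
  have h1 := hcdf ▸ tendsto_cdf_atTop P
  apply Subset.antisymm
  · rintro _ ⟨x, rfl⟩
    refine ⟨?_, ?_⟩
    · have : 0 ≤ F (x - 1) := by rw [hF]; exact ENNReal.toReal_nonneg
      exact this.trans_lt (hFm (by linarith))
    · have : F (x + 1) ≤ 1 := by rw [← hcdf]; exact cdf_le_one P _
      exact (hFm (by linarith)).trans_le this
  · rintro u ⟨hu0, hu1⟩
    exact mem_range_of_exists_le_of_exists_ge hFc
      ((h0.eventually_lt_const hu0).exists.imp fun _ => le_of_lt)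
      ((h1.eventually_const_lt hu1).exists.imp fun _ => le_of_lt)

/-- The quantile transform `T = Ft⁻¹ ∘ F` matches the two distribution functions. -/
theorem cdf_quantile_transform {P Pt : Measure ℝ} [IsProbabilityMeasure P]
    [IsProbabilityMeasure Pt] {F Ft T : ℝ → ℝ}
    (hF : ∀ x, F x = (P (Iic x)).toReal) (hFt : ∀ x, Ft x = (Pt (Iic x)).toReal)
    (hFc : Continuous F) (hFm : StrictMono F) (hFtc : Continuous Ft) (hFtm : StrictMono Ft)
    (hT : ∀ x, T x = sInf {y : ℝ | F x < Ft y}) (x : ℝ) : Ft (T x) = F x := by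
  have hx : F x ∈ range Ft := by
    rw [range_eq_Ioo_of_cdf hFt hFtc hFtm, ← range_eq_Ioo_of_cdf hF hFc hFm]
    exact mem_range_self x
  obtain ⟨y, hy⟩ := hx
  have : {z : ℝ | F x < Ft z} = Ioi y := by
    ext z
    rw [mem_ofPred_eq, ← hy, hFtm.lt_iff_lt, mem_Ioi]
  rw [hT, this, csInf_Ioi, hy]

/-- A map matching two continuous distribution functions transports one law to the other. -/
theorem map_eq_of_cdf_comp_eq {P Pt : Measure ℝ} [IsProbabilityMeasure P]
    [IsProbabilityMeasure Pt] {F Ft T : ℝ → ℝ}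
    (hF : ∀ x, F x = (P (Iic x)).toReal) (hFt : ∀ x, Ft x = (Pt (Iic x)).toReal)
    (hFc : Continuous F) (hFm : StrictMono F) (hFtc : Continuous Ft) (hFtm : StrictMono Ft)
    (hTm : Measurable T) (hT : ∀ x, Ft (T x) = F x) : P.map T = Pt := by
  have : IsProbabilityMeasure (P.map T) := Measure.isProbabilityMeasure_map hTm.aemeasurable
  refine Measure.ext_of_Iic _ _ fun t => ?_
  obtain ⟨s, hs⟩ : Ft t ∈ range F := by
    rw [range_eq_Ioo_of_cdf hF hFc hFm, ← range_eq_Ioo_of_cdf hFt hFtc hFtm]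
    exact mem_range_self t
  have hset : T ⁻¹' Iic t = Iic s := by
    ext x
    rw [mem_preimage, mem_Iic, mem_Iic, ← hFtm.le_iff_le, hT, ← hs, hFm.le_iff_le]
  rw [Measure.map_apply hTm measurableSet_Iic, hset,
    ← ENNReal.toReal_eq_toReal_iff' (measure_ne_top _ _) (measure_ne_top _ _), ← hF, ← hFt, hs]

/-- A majorant of `|T y| ^ p` over `|y - x| ≤ h` for monotone `T`. -/
noncomputable def shiftEnvelope (T : ℝ → ℝ) (h p x : ℝ) : ℝ :=
  max (-T (x - h)) 0 ^ p + max (T (x + h)) 0 ^ p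

theorem shiftEnvelope_nonneg (T : ℝ → ℝ) (h p x : ℝ) : 0 ≤ shiftEnvelope T h p x := by
  unfold shiftEnvelope
  positivity

theorem abs_rpow_le_shiftEnvelope {T : ℝ → ℝ} (hT : Monotone T) {h p x y : ℝ} (hp : 0 ≤ p)
    (hxy : |y - x| ≤ h) : |T y| ^ p ≤ shiftEnvelope T h p x := by
  obtain ⟨h1, h2⟩ := abs_le.1 hxy
  have hl : T (x - h) ≤ T y := hT (by linarith)
  have hr : T y ≤ T (x + h) := hT (by linarith)
  unfold shiftEnvelope
  rcases le_total 0 (T y) with h0 | h0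
  · rw [abs_of_nonneg h0]
    refine (Real.rpow_le_rpow h0 (hr.trans (le_max_left _ 0)) hp).trans ?_
    exact le_add_of_nonneg_left (by positivity)
  · rw [abs_of_nonpos h0]
    refine (Real.rpow_le_rpow (by linarith) ((neg_le_neg hl).trans (le_max_left _ 0)) hp).trans ?_
    exact le_add_of_nonneg_right (by positivity)

/-- The envelope of a transport map is integrable, with a quantitative bound. -/
theorem integrable_shiftEnvelope_and_integral_le {P Pt : Measure ℝ} {T : ℝ → ℝ}
    (hT : Monotone T) (hmap : P.map T = Pt) {h p K : ℝ} (hp : 0 ≤ p) (hK : 0 ≤ K)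
    (hl : ∀ x, P (Iic (x + h)) ≤ ENNReal.ofReal K * P (Iic x))
    (hr : ∀ x, P (Ici (x - h)) ≤ ENNReal.ofReal K * P (Ici x))
    (hint : Integrable (fun x => |x| ^ p) Pt) :
    Integrable (shiftEnvelope T h p) P ∧
      ∫ x, shiftEnvelope T h p x ∂P ≤ 2 * K * ∫ x, |x| ^ p ∂Pt := by
  have hanti : Antitone fun x => max (-T x) 0 ^ p := fun x y hxy =>
    Real.rpow_le_rpow (le_max_right _ _) (max_le_max_right _ (neg_le_neg (hT hxy))) hp
  have hmono : Monotone fun x => max (T x) 0 ^ p := fun x y hxy =>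
    Real.rpow_le_rpow (le_max_right _ _) (max_le_max_right _ (hT hxy)) hp
  have hm1 : Measurable fun x => max (-T (x - h)) 0 ^ p :=
    hanti.measurable.comp (measurable_id.sub_const h)
  have hm2 : Measurable fun x => max (T (x + h)) 0 ^ p :=
    hmono.measurable.comp (measurable_id.add_const h)
  have hI0 : 0 ≤ ∫ x, |x| ^ p ∂Pt := integral_nonneg fun x => by positivity
  have hI : ∫⁻ x, ENNReal.ofReal (|T x| ^ p) ∂P = ENNReal.ofReal (∫ x, |x| ^ p ∂Pt) := by
    rw [ofReal_integral_eq_lintegral_ofReal hint (.of_forall fun x => by positivity), ← hmap,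
      lintegral_map (by fun_prop) hT.measurable]
  have hbound : ∫⁻ x, ENNReal.ofReal (shiftEnvelope T h p x) ∂P
      ≤ ENNReal.ofReal (2 * K * ∫ x, |x| ^ p ∂Pt) := by
    have hsum : ∀ x, ENNReal.ofReal (shiftEnvelope T h p x)
        = ENNReal.ofReal (max (-T (x - h)) 0 ^ p) + ENNReal.ofReal (max (T (x + h)) 0 ^ p) :=
      fun x => ENNReal.ofReal_add (by positivity) (by positivity)
    simp_rw [hsum]
    rw [lintegral_add_left hm1.ennreal_ofReal, mul_assoc, two_mul,
      ENNReal.ofReal_add (by positivity) (by positivity), ENNReal.ofReal_mul hK, ← hI]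
    refine add_le_add
      ((hanti.lintegral_ofReal_shift_le ENNReal.ofReal_ne_top hl fun x => by positivity).trans ?_)
      ((hmono.lintegral_ofReal_shift_le ENNReal.ofReal_ne_top hr fun x => by positivity).trans ?_)
    · gcongr with x
      exact max_le (neg_le_abs _) (abs_nonneg _)
    · gcongr with x
      exact max_le (le_abs_self _) (abs_nonneg _)
  have hmeas : Measurable (shiftEnvelope T h p) := hm1.add hm2
  have hi : Integrable (shiftEnvelope T h p) P := by
    refine ⟨hmeas.aestronglyMeasurable, ?_⟩
    rw [hasFiniteIntegral_iff_ofReal (.of_forall (shiftEnvelope_nonneg T h p))]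
    exact hbound.trans_lt ENNReal.ofReal_lt_top
  refine ⟨hi, ?_⟩
  rwa [← ofReal_integral_eq_lintegral_ofReal hi (.of_forall (shiftEnvelope_nonneg T h p)),
    ENNReal.ofReal_le_ofReal_iff (by positivity)] at hbound

theorem integrable_abs_rpow_of_le {P : Measure ℝ} [IsFiniteMeasure P] {p q : ℝ} (hp : 0 ≤ p)
    (hpq : p ≤ q) (h : Integrable (fun x => |x| ^ q) P) : Integrable (fun x => |x| ^ p) P := by
  refine ((integrable_const (1 : ℝ)).add h).mono' (by fun_prop) (.of_forall fun x => ?_)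
  rw [Real.norm_of_nonneg (by positivity), Pi.add_apply]
  rcases le_total |x| 1 with hx | hx
  · exact (Real.rpow_le_one (abs_nonneg x) hx hp).trans (le_add_of_nonneg_right (by positivity))
  · exact (Real.rpow_le_rpow_of_exponent_le hx hpq).trans (le_add_of_nonneg_left zero_le_one)

theorem monotone_rpow_mul_self {r : ℝ} (hr : 1 < r) : Monotone fun w : ℝ => |w| ^ (r - 2) * w := by
  have key : ∀ w : ℝ, 0 ≤ w → |w| ^ (r - 2) * w = w ^ (r - 1) := by
    intro w hw
    rcases hw.eq_or_lt with rfl | hw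
    · rw [mul_zero, Real.zero_rpow (by linarith)]
    · rw [abs_of_pos hw, ← Real.rpow_add_one hw.ne']
      congr 1
      ring
  refine monotone_of_odd_of_monotoneOn_nonneg (fun x => by simp) fun x hx y hy hxy => ?_
  rw [key x hx, key y hy]
  exact Real.rpow_le_rpow hx hxy (by linarith)

theorem abs_rpow_mul_self {r : ℝ} (hr : 1 < r) (w : ℝ) : |w| ^ (r - 2) * |w| = |w| ^ (r - 1) := by
  rcases (abs_nonneg w).eq_or_lt with hw | hw
  · rw [← hw, mul_zero, Real.zero_rpow (by linarith)]
  · rw [← Real.rpow_add_one hw.ne']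
    congr 1
    ring

/-- The one-sided Kantorovich potential inequality for a monotone map. -/
theorem potential_sub_le {r : ℝ} (hr : 1 < r) {T ψ : ℝ → ℝ} (hT : Monotone T)
    (hψ : Differentiable ℝ ψ)
    (hψ' : ∀ x, deriv ψ x = r * |x - T x| ^ (r - 2) * (T x - x)) (x z : ℝ) :
    ψ x - ψ z ≤ |z - T x| ^ r := by
  have hd : ∀ u, HasDerivAt (fun u => ψ u + |u - T x| ^ r)
      (r * (|u - T x| ^ (r - 2) * (u - T x) - |u - T u| ^ (r - 2) * (u - T u))) u := by
    intro u
    have h1 := (hasDerivAt_abs_rpow (u - T x) hr).comp u ((hasDerivAt_id u).sub_const (T x))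
    refine ((hψ u).hasDerivAt.add h1).congr_deriv ?_
    rw [hψ']
    ring
  have hcont : Continuous fun u => ψ u + |u - T x| ^ r :=
    continuous_iff_continuousAt.2 fun u => (hd u).continuousAt
  have key : ψ x + |x - T x| ^ r ≤ ψ z + |z - T x| ^ r := by
    rcases le_total x z with hxz | hxz
    · refine monotoneOn_of_deriv_nonneg (convex_Ici x) hcont.continuousOn
        (fun u _ => (hd u).differentiableAt.differentiableWithinAt) (fun u hu => ?_)
        (mem_Ici.2 le_rfl) hxz hxz
      rw [interior_Ici] at hu
      rw [(hd u).deriv]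
      exact mul_nonneg (by linarith) (sub_nonneg.2
        (monotone_rpow_mul_self hr (sub_le_sub_left (hT (le_of_lt hu)) u)))
    · refine antitoneOn_of_deriv_nonpos (convex_Iic x) hcont.continuousOn
        (fun u _ => (hd u).differentiableAt.differentiableWithinAt) (fun u hu => ?_)
        hxz (mem_Iic.2 le_rfl) hxz
      rw [interior_Iic] at hu
      rw [(hd u).deriv]
      exact mul_nonpos_of_nonneg_of_nonpos (by linarith) (sub_nonpos.2
        (monotone_rpow_mul_self hr (sub_le_sub_left (hT (le_of_lt hu)) u)))
  have : 0 ≤ |x - T x| ^ r := by positivity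
  linarith

/-- Pointwise bound for the drift part of the generator. -/
theorem abs_drift_rpow_le {r α Vn a x y : ℝ} (hr : 1 < r) (hα : 1 ≤ α) (hVn : 0 ≤ Vn)
    {T ψ : ℝ → ℝ} (hT : Monotone T)
    (hψ' : ∀ x, deriv ψ x = r * |x - T x| ^ (r - 2) * (T x - x))
    (hxy : |y - x| ≤ Vn) (ha : |a| ≤ Vn * |deriv ψ y|) :
    |a| ^ α ≤ Vn ^ α * r ^ α * (2 ^ max (α * (r - 1) - 1) 0 *
      (shiftEnvelope T Vn (α * (r - 1)) x
        + 2 ^ max (α * (r - 1) - 1) 0 * (|x| ^ (α * (r - 1)) + Vn ^ (α * (r - 1))))) := by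
  have hβ : 0 ≤ α * (r - 1) := mul_nonneg (by linarith) (by linarith)
  have hd : |deriv ψ y| = r * |y - T y| ^ (r - 1) := by
    rw [hψ', abs_mul, abs_mul, abs_of_nonneg (by linarith : (0 : ℝ) ≤ r),
      abs_of_nonneg (by positivity : (0 : ℝ) ≤ |y - T y| ^ (r - 2)), abs_sub_comm (T y) y,
      mul_assoc, abs_rpow_mul_self hr]
  have hr0 : 0 ≤ r := by linarith
  have hpow : |a| ^ α ≤ Vn ^ α * r ^ α * |y - T y| ^ (α * (r - 1)) := by
    refine (Real.rpow_le_rpow (abs_nonneg a) (hd ▸ ha) (by linarith)).trans_eq ?_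
    rw [Real.mul_rpow hVn (by positivity), Real.mul_rpow hr0 (by positivity),
      ← Real.rpow_mul (abs_nonneg _), mul_comm (r - 1), mul_assoc]
  refine hpow.trans (mul_le_mul_of_nonneg_left ?_ (by positivity))
  have hyx : |y| ≤ |x| + Vn := by
    have := abs_sub_abs_le_abs_sub y x
    linarith
  calc |y - T y| ^ (α * (r - 1)) ≤ (|T y| + |y|) ^ (α * (r - 1)) :=
        Real.rpow_le_rpow (abs_nonneg _) ((abs_sub y (T y)).trans_eq (add_comm _ _)) hβ
    _ ≤ _ := rpow_add_le_two_rpow_mul (abs_nonneg _) (abs_nonneg _) hβ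
    _ ≤ _ := by
      gcongr
      · exact abs_rpow_le_shiftEnvelope hT hβ hxy
      · exact (Real.rpow_le_rpow (abs_nonneg _) hyx hβ).trans
          (rpow_add_le_two_rpow_mul (abs_nonneg _) hVn hβ)

/-- Pointwise bound for the jump part of the generator. -/
theorem abs_jump_rpow_le {r α M x : ℝ} (hr : 1 < r) (hα : 1 ≤ α) (hM : 0 < M)
    {T ψ : ℝ → ℝ} (hT : Monotone T) (hψ : Differentiable ℝ ψ)
    (hψ' : ∀ x, deriv ψ x = r * |x - T x| ^ (r - 2) * (T x - x))
    {m : Measure ℝ} [IsProbabilityMeasure m] (hm : m {y | M < |x - y|} = 0) :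
    |∫ z, (ψ z - ψ x) ∂m| ^ α ≤ 2 ^ (α * r - 1) *
      ((1 + 2 ^ (α * r - 1)) * |x| ^ (α * r) + 2 ^ (α * r - 1) * M ^ (α * r)
        + (|T x| ^ (α * r) + shiftEnvelope T M (α * r) x)) := by
  have hα0 : 0 < α := by linarith
  have hγ1 : 1 ≤ α * r := by nlinarith
  have hγ : 0 ≤ α * r := by linarith
  have hmax : max (α * r - 1) 0 = α * r - 1 := max_eq_left (by linarith)
  have hadd : ∀ {a b : ℝ}, 0 ≤ a → 0 ≤ b →
      (a + b) ^ (α * r) ≤ 2 ^ (α * r - 1) * (a ^ (α * r) + b ^ (α * r)) := fun ha hb =>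
    hmax ▸ rpow_add_le_two_rpow_mul ha hb hγ
  have hS := shiftEnvelope_nonneg T M (α * r) x
  set B := 2 ^ (α * r - 1) * ((1 + 2 ^ (α * r - 1)) * |x| ^ (α * r)
    + 2 ^ (α * r - 1) * M ^ (α * r) + (|T x| ^ (α * r) + shiftEnvelope T M (α * r) x)) with hB
  have hB0 : 0 ≤ B := by positivity
  have hz : ∀ z, |x - z| ≤ M → |ψ z - ψ x| ≤ B ^ α⁻¹ := by
    intro z hxz
    have hsplit : ∀ a b : ℝ, (|a - b| ^ r) ^ α
        ≤ 2 ^ (α * r - 1) * (|a| ^ (α * r) + |b| ^ (α * r)) := by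
      intro a b
      rw [← Real.rpow_mul (abs_nonneg _), mul_comm r]
      exact (Real.rpow_le_rpow (abs_nonneg _) (abs_sub a b) hγ).trans
        (hadd (abs_nonneg _) (abs_nonneg _))
    have hzpow : |z| ^ (α * r) ≤ 2 ^ (α * r - 1) * (|x| ^ (α * r) + M ^ (α * r)) := by
      refine (Real.rpow_le_rpow (abs_nonneg _) ?_ hγ).trans (hadd (abs_nonneg x) hM.le)
      have := abs_sub_abs_le_abs_sub z x
      rw [abs_sub_comm] at this
      linarith
    have hTz : |T z| ^ (α * r) ≤ shiftEnvelope T M (α * r) x :=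
      abs_rpow_le_shiftEnvelope hT hγ (by rwa [abs_sub_comm])
    have h1 : |z - T x| ^ r ≤ B ^ α⁻¹ := by
      rw [Real.le_rpow_inv_iff_of_pos (by positivity) hB0 hα0]
      refine (hsplit z (T x)).trans ?_
      refine mul_le_mul_of_nonneg_left ?_ (by positivity)
      have : 0 ≤ |x| ^ (α * r) := by positivity
      linarith
    have h2 : |x - T z| ^ r ≤ B ^ α⁻¹ := by
      rw [Real.le_rpow_inv_iff_of_pos (by positivity) hB0 hα0]
      refine (hsplit x (T z)).trans ?_
      refine mul_le_mul_of_nonneg_left ?_ (by positivity)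
      have h3 : 0 ≤ 2 ^ (α * r - 1) * |x| ^ (α * r) := by positivity
      have h4 : 0 ≤ 2 ^ (α * r - 1) * M ^ (α * r) := by positivity
      have h5 : 0 ≤ |T x| ^ (α * r) := by positivity
      linarith
    rw [abs_le]
    have h3 := potential_sub_le hr hT hψ hψ' x z
    have h4 := potential_sub_le hr hT hψ hψ' z x
    constructor <;> linarith
  have hae : ∀ᵐ z ∂m, ‖ψ z - ψ x‖ ≤ B ^ α⁻¹ := by
    have : ∀ᵐ z ∂m, ¬ M < |x - z| := by
      rw [ae_iff]
      simpa using hm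
    exact this.mono fun z h => hz z (not_lt.1 h)
  have hint := norm_integral_le_of_norm_le_const hae
  rw [probReal_univ, mul_one, Real.norm_eq_abs] at hint
  rwa [← Real.le_rpow_inv_iff_of_pos (abs_nonneg _) hB0 hα0]

/-- A constant dominating all positive shifts of a strictly increasing positive function is at
least one. -/
theorem one_le_of_shift_le {F : ℝ → ℝ} (hFm : StrictMono F) {c C : ℝ} (hc : 0 < c) (hC : 0 < C)
    (h : ∀ y, 0 < y → F y ≤ c * Real.exp (C * y) * F 0) : 1 ≤ c := by
  by_contra! hlt
  have hy : 0 < -Real.log c / C := div_pos (neg_pos.2 (Real.log_neg hc hlt)) hC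
  have h1 := h _ hy
  rw [mul_div_cancel₀ _ hC.ne', Real.exp_neg, Real.exp_log hc, mul_inv_cancel₀ hc.ne',
    one_mul] at h1
  exact h1.not_gt (hFm hy)

/-- `L^α(P)` bound, uniform in `μ ∈ [1,∞]`, for the generators `L^μ` of the
jump approximations of a PDMP applied to the Kantorovich potential `ψ` of the
`ρ`-Wasserstein distance from `P` to `P̃`, for `P, P̃ ∈ 𝒫̂_{ρα}`. -/
theorem stmt18 (ρ α : ℝ) (hρ : 1 < ρ) (hα : 1 ≤ α)
    (V : ℝ → ℝ) (hVlip : LocallyLipschitz V)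
    (hVbdd : BddAbove (Set.range fun x => |V x|))
    (Φ : ℝ → ℝ → ℝ) (hΦ0 : ∀ x, Φ x 0 = x)
    (hΦ' : ∀ x t, HasDerivAt (Φ x) (V (Φ x t)) t)
    (l : ℝ → ℝ) (hlc : Continuous l) (hl0 : ∀ x, 0 ≤ l x)
    (hlbdd : BddAbove (Set.range l))
    (k : Kernel ℝ ℝ) [IsMarkovKernel k]
    (M : ℝ) (hM : 0 < M) (hjump : ∀ x, k x {y | M < |x - y|} = 0)
    (P Pt : Measure ℝ) [IsProbabilityMeasure P] [IsProbabilityMeasure Pt]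
    (F Ft : ℝ → ℝ)
    (hF : ∀ x, F x = (P (Iic x)).toReal) (hFt : ∀ x, Ft x = (Pt (Iic x)).toReal)
    (hFc : Continuous F) (hFm : StrictMono F)
    (hFtc : Continuous Ft) (hFtm : StrictMono Ft)
    (hPm : Integrable (fun x => |x| ^ (ρ * α)) P)
    (hPtm : Integrable (fun x => |x| ^ (ρ * α)) Pt)
    (c C : ℝ) (hc : 0 < c) (hC : 0 < C)
    (htail : ∀ y : ℝ, 0 < y → ∀ x : ℝ,
      F (x + y) ≤ c * Real.exp (C * y) * F x ∧
      1 - F (x - y) ≤ c * Real.exp (C * y) * (1 - F x))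
    (Ftinv : ℝ → ℝ) (hFtinv : ∀ u, Ftinv u = sInf {x : ℝ | u < Ft x})
    (T : ℝ → ℝ) (hT : ∀ x, T x = Ftinv (F x))
    (ψ : ℝ → ℝ) (hψ : ContDiff ℝ 1 ψ)
    (hψ' : ∀ x, deriv ψ x = ρ * |x - T x| ^ (ρ - 2) * (T x - x)) :
    (∀ μ : ℝ, 1 ≤ μ →
      ∫⁻ x, ENNReal.ofReal
          (|μ * (ψ (Φ x (1 / μ)) - ψ x) + l x * ∫ z, (ψ z - ψ x) ∂(k x)| ^ α) ∂P
        ≤ ENNReal.ofReal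
            (stmt18RHS ρ α (⨆ x, |V x|) (⨆ x, l x) c C M P Pt)) ∧
    (∫⁻ x, ENNReal.ofReal
        (|V x * deriv ψ x + l x * ∫ z, (ψ z - ψ x) ∂(k x)| ^ α) ∂P
      ≤ ENNReal.ofReal (stmt18RHS ρ α (⨆ x, |V x|) (⨆ x, l x) c C M P Pt)) := by
  have hTmatch : ∀ x, Ft (T x) = F x :=
    cdf_quantile_transform hF hFt hFc hFm hFtc hFtm fun x => (hT x).trans (hFtinv _)
  have hTmono : Monotone T := fun x y hxy => by
    rw [← hFtm.le_iff_le, hTmatch, hTmatch]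
    exact hFm.monotone hxy
  have hmap : P.map T = Pt :=
    map_eq_of_cdf_comp_eq hF hFt hFc hFm hFtc hFtm hTmono.measurable hTmatch
  have hatoms : NullSingletonClass P := nullSingletonClass_of_continuous_cdf hF hFc
  have hFeq : ∀ x, P (Iic x) = ENNReal.ofReal (F x) := fun x => by
    rw [hF, ENNReal.ofReal_toReal (measure_ne_top _ _)]
  have hFbar : ∀ x, P (Ici x) = ENNReal.ofReal (1 - F x) := fun x => by
    rw [← measure_congr Ioi_ae_eq_Ici, ← compl_Iic, prob_compl_eq_one_sub measurableSet_Iic,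
      hFeq, ENNReal.ofReal_sub _ (hF x ▸ ENNReal.toReal_nonneg), ENNReal.ofReal_one]
  have hc1 : 1 ≤ c := one_le_of_shift_le hFm hc hC fun y hy => by
    simpa using (htail y hy 0).1
  have hK0 : ∀ h, 0 ≤ c * Real.exp (C * h) := fun h => by positivity
  have hleft : ∀ h, 0 ≤ h → ∀ x,
      P (Iic (x + h)) ≤ ENNReal.ofReal (c * Real.exp (C * h)) * P (Iic x) := by
    intro h hh x
    rcases hh.eq_or_lt with rfl | hh
    · simpa using le_mul_of_one_le_left' (ENNReal.one_le_ofReal.2 hc1)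
    · rw [hFeq, hFeq, ← ENNReal.ofReal_mul (hK0 h)]
      exact ENNReal.ofReal_le_ofReal (htail h hh x).1
  have hright : ∀ h, 0 ≤ h → ∀ x,
      P (Ici (x - h)) ≤ ENNReal.ofReal (c * Real.exp (C * h)) * P (Ici x) := by
    intro h hh x
    rcases hh.eq_or_lt with rfl | hh
    · simpa using le_mul_of_one_le_left' (ENNReal.one_le_ofReal.2 hc1)
    · rw [hFbar, hFbar, ← ENNReal.ofReal_mul (hK0 h)]
      exact ENNReal.ofReal_le_ofReal (htail h hh x).2
  set Vn := ⨆ x, |V x|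
  set lbar := ⨆ x, l x
  have hVle : ∀ x, |V x| ≤ Vn := fun x => le_ciSup hVbdd x
  have hVn0 : 0 ≤ Vn := (abs_nonneg _).trans (hVle 0)
  have hlle : ∀ x, l x ≤ lbar := fun x => le_ciSup hlbdd x
  have hlbar0 : 0 ≤ lbar := (hl0 0).trans (hlle 0)
  have hψd : Differentiable ℝ ψ := hψ.differentiable one_ne_zero
  have hα0 : 0 < α := by linarith
  have hβ : 0 ≤ α * (ρ - 1) := mul_nonneg hα0.le (by linarith)
  have hγ : 0 ≤ α * ρ := mul_nonneg hα0.le (by linarith)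
  have hβγ : α * (ρ - 1) ≤ α * ρ := by nlinarith
  rw [mul_comm ρ α] at hPm hPtm
  have hPβ := integrable_abs_rpow_of_le hβ hβγ hPm
  have hPtβ := integrable_abs_rpow_of_le hβ hβγ hPtm
  obtain ⟨hS1i, hS1⟩ := integrable_shiftEnvelope_and_integral_le hTmono hmap hβ (hK0 Vn)
    (hleft Vn hVn0) (hright Vn hVn0) hPtβ
  obtain ⟨hS2i, hS2⟩ := integrable_shiftEnvelope_and_integral_le hTmono hmap hγ (hK0 M)
    (hleft M hM.le) (hright M hM.le) hPtm
  have hTi : Integrable (fun x => |T x| ^ (α * ρ)) P := by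
    rw [← hmap] at hPtm
    exact hPtm.comp_measurable hTmono.measurable
  have hTint : ∫ x, |T x| ^ (α * ρ) ∂P = ∫ x, |x| ^ (α * ρ) ∂Pt := by
    rw [← hmap, integral_map hTmono.measurable.aemeasurable (by fun_prop)]
  set κ : ℝ := 2 ^ max (α * (ρ - 1) - 1) 0 with hκ
  set κ' : ℝ := 2 ^ (α * ρ - 1) with hκ'
  set A : ℝ := 2 ^ (α - 1) * (Vn ^ α * ρ ^ α * κ) with hA
  set D : ℝ := 2 ^ (α - 1) * (lbar ^ α * κ') with hD
  have hρ0 : 0 < ρ := by linarith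
  have hA0 : 0 ≤ A := by positivity
  have hD0 : 0 ≤ D := by positivity
  set G₁ : ℝ → ℝ := fun x => shiftEnvelope T Vn (α * (ρ - 1)) x
    + κ * (|x| ^ (α * (ρ - 1)) + Vn ^ (α * (ρ - 1))) with hG₁
  set G₂ : ℝ → ℝ := fun x => ((1 + κ') * |x| ^ (α * ρ) + κ' * M ^ (α * ρ))
    + (|T x| ^ (α * ρ) + shiftEnvelope T M (α * ρ) x) with hG₂
  have hX₁ : Integrable (fun x => |x| ^ (α * (ρ - 1)) + Vn ^ (α * (ρ - 1))) P :=
    hPβ.add (integrable_const _)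
  have hX₂ : Integrable (fun x => (1 + κ') * |x| ^ (α * ρ) + κ' * M ^ (α * ρ)) P :=
    (hPm.const_mul _).add (integrable_const _)
  have hX₃ : Integrable (fun x => |T x| ^ (α * ρ) + shiftEnvelope T M (α * ρ) x) P :=
    hTi.add hS2i
  have hG₁i : Integrable G₁ P := hS1i.add (hX₁.const_mul κ)
  have hG₂i : Integrable G₂ P := hX₂.add hX₃
  have hG₁int : ∫ x, G₁ x ∂P ≤ 2 * c * Real.exp (C * Vn) * (∫ x, |x| ^ (α * (ρ - 1)) ∂Pt)
      + κ * ((∫ x, |x| ^ (α * (ρ - 1)) ∂P) + Vn ^ (α * (ρ - 1))) := by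
    simp only [hG₁]
    rw [integral_add hS1i (hX₁.const_mul κ), integral_const_mul,
      integral_add hPβ (integrable_const _), integral_const, probReal_univ, one_smul]
    linarith
  have hG₂int : ∫ x, G₂ x ∂P ≤ (1 + κ') * (∫ x, |x| ^ (α * ρ) ∂P) + κ' * M ^ (α * ρ)
      + (1 + 2 * c * Real.exp (C * M)) * (∫ x, |x| ^ (α * ρ) ∂Pt) := by
    simp only [hG₂]
    rw [integral_add hX₂ hX₃, integral_add (hPm.const_mul _) (integrable_const _),
      integral_add hTi hS2i, integral_const_mul, integral_const, probReal_univ, one_smul, hTint]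
    linarith
  have hbound : ∀ a : ℝ → ℝ, (∀ x, ∃ y, |y - x| ≤ Vn ∧ |a x| ≤ Vn * |deriv ψ y|) →
      ∫⁻ x, ENNReal.ofReal (|a x + l x * ∫ z, (ψ z - ψ x) ∂(k x)| ^ α) ∂P
        ≤ ENNReal.ofReal (stmt18RHS ρ α Vn lbar c C M P Pt) := by
    intro a ha
    have hpt : ∀ x, |a x + l x * ∫ z, (ψ z - ψ x) ∂(k x)| ^ α ≤ A * G₁ x + D * G₂ x := by
      intro x
      obtain ⟨y, hy, hay⟩ := ha x
      have hdrift := abs_drift_rpow_le hρ hα hVn0 hTmono hψ' hy hay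
      have hjmp := abs_jump_rpow_le hρ hα hM hTmono hψd hψ' (hjump x)
      have hljmp : |l x * ∫ z, (ψ z - ψ x) ∂(k x)| ^ α ≤ lbar ^ α * (κ' * G₂ x) := by
        rw [abs_mul, Real.mul_rpow (abs_nonneg _) (abs_nonneg _), abs_of_nonneg (hl0 x)]
        exact mul_le_mul (Real.rpow_le_rpow (hl0 x) (hlle x) hα0.le) hjmp (by positivity)
          (by positivity)
      have h2 := rpow_add_le_two_rpow_mul (abs_nonneg (a x))
        (abs_nonneg (l x * ∫ z, (ψ z - ψ x) ∂(k x))) hα0.le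
      rw [max_eq_left (by linarith)] at h2
      refine (Real.rpow_le_rpow (abs_nonneg _) (abs_add_le _ _) hα0.le).trans (h2.trans ?_)
      refine (mul_le_mul_of_nonneg_left (add_le_add hdrift hljmp) (by positivity)).trans_eq ?_
      rw [hA, hD, hG₁]
      ring
    have hi : Integrable (fun x => A * G₁ x + D * G₂ x) P :=
      (hG₁i.const_mul A).add (hG₂i.const_mul D)
    refine (lintegral_mono fun x => ENNReal.ofReal_le_ofReal (hpt x)).trans ?_
    rw [← ofReal_integral_eq_lintegral_ofReal hi
      (.of_forall fun x => le_trans (by positivity) (hpt x)),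
      integral_add (hG₁i.const_mul A) (hG₂i.const_mul D), integral_const_mul, integral_const_mul]
    refine ENNReal.ofReal_le_ofReal ((add_le_add (mul_le_mul_of_nonneg_left hG₁int hA0)
      (mul_le_mul_of_nonneg_left hG₂int hD0)).trans_eq ?_)
    rw [stmt18RHS, hA, hD, hκ, hκ']
    ring
  refine ⟨fun μ hμ => hbound _ fun x => ?_, hbound _ fun x => ⟨x, by simpa using hVn0, ?_⟩⟩
  · have hμ0 : 0 < μ := by linarith
    have hd : ∀ t, HasDerivAt (fun t => ψ (Φ x t)) (deriv ψ (Φ x t) * V (Φ x t)) t := fun t =>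
      (hψd _).hasDerivAt.comp t (hΦ' x t)
    obtain ⟨s, hs, hslope⟩ := exists_hasDerivAt_eq_slope (fun t => ψ (Φ x t)) _
      (one_div_pos.2 hμ0) (continuous_iff_continuousAt.2 fun t => (hd t).continuousAt).continuousOn
      fun t _ => hd t
    refine ⟨Φ x s, ?_, ?_⟩
    · have hs1 : s ≤ 1 := hs.2.le.trans ((div_le_one hμ0).2 hμ)
      have := convex_univ.norm_image_sub_le_of_norm_hasDerivWithin_le
        (fun t _ => (hΦ' x t).hasDerivWithinAt) (fun t _ => hVle (Φ x t)) (mem_univ 0) (mem_univ s)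
      rw [hΦ0, sub_zero, Real.norm_eq_abs, Real.norm_eq_abs, abs_of_pos hs.1] at this
      exact this.trans (mul_le_of_le_one_right hVn0 hs1)
    · have : μ * (ψ (Φ x (1 / μ)) - ψ x) = deriv ψ (Φ x s) * V (Φ x s) := by
        rw [hslope, hΦ0, sub_zero, div_div_eq_mul_div, div_one, mul_comm]
      rw [this, abs_mul, mul_comm]
      exact mul_le_mul_of_nonneg_right (hVle _) (abs_nonneg _)
  · rw [abs_mul]
    exact mul_le_mul_of_nonneg_right (hVle x) (abs_nonneg _)
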